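/- Let p be a prime number with p ∉ {2, 3, 5, 7, 11, 131, 193, 599, 3541, 8009}, and let K be an algebraically closed field of characteristic p. If P ∈ K[X] is a polynomial of degree 5 such that for every integer i with 1 ≤ i ≤ 4 the polynomials P and its i-th Hasse derivative are not coprime, then there exist c, r ∈ K such that P = c·(X − r)^5. -/

import Mathlib

open Polynomial

theorem ca_core1 {K : Type*} [Field K] (h2 : (2:K) ≠ 0) (h3 : (3:K) ≠ 0) (h7 : (7:K) ≠ 0)
    (h11 : (11:K) ≠ 0) (h131 : (131:K) ≠ 0) (h599 : (599:K) ≠ 0) (h3541 : (3541:K) ≠ 0)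
    (h8009 : (8009:K) ≠ 0) (c s t : K)
    (hs : s^5 - 10*s^3 + c*s^2 + (9-c)*s = 0) (hc : 10*s^3 - 30*s + c = 0)
    (ht : t^5 - 10*t^3 + c*t^2 + (9-c)*t = 0)
    (ht' : 5*t^4 - 30*t^2 + 2*c*t + (9-c) = 0) : False := by
  obtain rfl : c = 30*s - 10*s^3 := by linear_combination hc
  have e : s * ((s-1) * (9*s^3 - s^2 - 21*s + 9)) = 0 := by linear_combination -hs
  rcases mul_eq_zero.1 e with rfl | e
  · have e2 : t * ((t-1) * ((t+1)*((t-3)*(t+3)))) = 0 := by linear_combination ht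
    rcases mul_eq_zero.1 e2 with rfl | e2
    · have : (3:K)^2 = 0 := by linear_combination ht'
      simp_all
    rcases mul_eq_zero.1 e2 with e2 | e2
    · obtain rfl : t = 1 := by linear_combination e2
      have : (2:K)^4 = 0 := by linear_combination -ht'
      simp_all
    rcases mul_eq_zero.1 e2 with e2 | e2
    · obtain rfl : t = -1 := by linear_combination e2
      have : (2:K)^4 = 0 := by linear_combination -ht'
      simp_all
    rcases mul_eq_zero.1 e2 with e2 | e2
    · obtain rfl : t = 3 := by linear_combination e2
      have : (2:K)^4*3^2 = 0 := by linear_combination ht'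
      simp_all
    · obtain rfl : t = -3 := by linear_combination e2
      have : (2:K)^4*3^2 = 0 := by linear_combination ht'
      simp_all
  rcases mul_eq_zero.1 e with e | e
  · obtain rfl : s = 1 := by linear_combination e
    have e2 : t * ((t-1) * (t^3+t^2-9*t+11)) = 0 := by linear_combination ht
    rcases mul_eq_zero.1 e2 with rfl | e2
    · have : (11:K) = 0 := by linear_combination -ht'
      simp_all
    rcases mul_eq_zero.1 e2 with e2 | e2
    · obtain rfl : t = 1 := by linear_combination e2
      have : (2:K)^2 = 0 := by linear_combination ht'
      simp_all
    have e3 : t * ((t-1) * (3*t^2+2*t-9)) = 0 := by linear_combination ht' - (2*t-1)*e2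
    rcases mul_eq_zero.1 e3 with rfl | e3
    · have : (11:K) = 0 := by linear_combination e2
      simp_all
    rcases mul_eq_zero.1 e3 with e3 | e3
    · obtain rfl : t = 1 := by linear_combination e3
      have : (2:K)^2 = 0 := by linear_combination e2
      simp_all
    have : (2:K)^2*131 = 0 := by
      linear_combination (109+42*t)*e2 + (75-41*t-14*t^2)*e3
    simp_all
  have e2 : t * ((t-1) * ((t-s) * (t^2+(1+s)*t+(s^2+s-9)))) = 0 := by
    linear_combination ht + (t^2-t)*e
  have e3 : (t-1) * ((t-s) * (t^2+(1+s)*t+(s^2+s-9))) + t * ((t-s) * (t^2+(1+s)*t+(s^2+s-9)))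
      + t * (t-1) * (t^2+(1+s)*t+(s^2+s-9)) + t*(t-1)*(t-s)*(2*t+1+s) = 0 := by
    linear_combination ht' + (2*t-1)*e
  have c0 : 10*s^3-30*s+9 ≠ 0 := by
    intro h
    have : (3:K)^3*3541 = 0 := by
      linear_combination (36330 + 2100*s-11300*s^2)*e + (-25707 -3020*s+10170*s^2)*h
    simp_all
  have c1 : 10*s^3-30*s+16 ≠ 0 := by
    intro h
    have : (2:K)^3*599 = 0 := by
      linear_combination (-5880 + 3850*s+3450*s^2)*e + (3607 -3120*s-3105*s^2)*h
    simp_all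
  have c2 : 3*s^2+2*s-9 ≠ 0 := by
    intro h
    have : (2:K)^2*3^2*7 = 0 := by
      linear_combination (43+24*s)*e + (15 -73*s-72*s^2)*h
    simp_all
  have c3 : 3*s^2+2*s-37 ≠ 0 := by
    intro h
    have : (2:K)^2*7*8009 = 0 := by
      linear_combination (316+213*s)*e + (-5984 -451*s-639*s^2)*h
    simp_all
  by_cases t0 : t = 0
  · subst t0
    exact c0 (by linear_combination ht')
  by_cases t1 : t - 1 = 0
  · obtain rfl : t = 1 := by linear_combination t1
    exact c1 (by linear_combination -ht')
  by_cases t2 : t - s = 0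
  · obtain rfl : t = s := by linear_combination t2
    have : t*((t-1)*(3*t^2+2*t-9)) = 0 := by linear_combination e3
    rcases mul_eq_zero.1 this with h | h
    · exact t0 h
    rcases mul_eq_zero.1 h with h | h
    · exact t1 h
    · exact c2 h
  have q : t^2+(1+s)*t+(s^2+s-9) = 0 := by simp_all
  have q' : 2*t+1+s = 0 := by
    rw [q] at e3
    simp_all
  exact c3 (by linear_combination 4*q - (2*t+1+s)*q')

theorem ca_core0 {K : Type*} [Field K] (h2 : (2:K) ≠ 0) (h3 : (3:K) ≠ 0)
    (h193 : (193:K) ≠ 0) (c d s t : K)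
    (hs : s^5 + c*s^2 + d*s = 0) (hc : 10*s^3 + c = 0)
    (ht : t^5 + c*t^2 + d*t = 0)
    (ht' : 5*t^4 + 2*c*t + d = 0) : c = 0 ∧ d = 0 := by
  obtain rfl : c = -10*s^3 := by linear_combination hc
  by_cases s0 : s = 0
  · subst s0
    refine ⟨by ring, ?_⟩
    by_cases t0 : t = 0
    · subst t0
      linear_combination ht'
    have h1 : t * (t^4+d) = 0 := by linear_combination ht
    have h1 : t^4 + d = 0 := by simpa [t0] using h1
    have h4 : (2:K)^2 * d = 0 := by linear_combination 5*h1 - ht'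
    simpa [h2] using h4
  exfalso
  have hd : s * (d - 9*s^4) = 0 := by linear_combination hs
  have hd : d - 9*s^4 = 0 := by simpa [s0] using hd
  obtain rfl : d = 9*s^4 := by linear_combination hd
  obtain ⟨u, rfl⟩ : ∃ u, t = u * s := ⟨t/s, by field_simp⟩
  have e : s^5 * (u * ((u-1)*(u^3+u^2+u-9))) = 0 := by linear_combination ht
  have e' : s^4 * (5*u^4-20*u+9) = 0 := by linear_combination ht'
  have e : (u * ((u-1)*(u^3+u^2+u-9))) = 0 := by
    rcases mul_eq_zero.1 e with h | h
    · exact absurd h (pow_ne_zero _ s0)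
    · exact h
  have e' : (5*u^4-20*u+9) = 0 := by
    rcases mul_eq_zero.1 e' with h | h
    · exact absurd h (pow_ne_zero _ s0)
    · exact h
  clear ht ht' hs hc hd
  by_cases u0 : u = 0
  · subst u0
    have : (3:K)^2 = 0 := by linear_combination e'
    simp_all
  by_cases u1 : u - 1 = 0
  · obtain rfl : u = 1 := by linear_combination u1
    have : (2:K)*3 = 0 := by linear_combination -e'
    simp_all
  have q : u^3+u^2+u-9 = 0 := by simp_all
  have q' : u*((u-1)*(3*u^2+2*u+1)) = 0 := by linear_combination e' - (2*u-1)*q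
  have q' : 3*u^2+2*u+1 = 0 := by simp_all
  have : (2:K)*3*193 = 0 := by
    linear_combination (-127-6*u)*q + (15+43*u+2*u^2)*q'
  simp_all

theorem ca_core {K : Type*} [Field K] (h2 : (2:K) ≠ 0) (h3 : (3:K) ≠ 0) (h7 : (7:K) ≠ 0)
    (h11 : (11:K) ≠ 0) (h131 : (131:K) ≠ 0) (h193 : (193:K) ≠ 0) (h599 : (599:K) ≠ 0)
    (h3541 : (3541:K) ≠ 0) (h8009 : (8009:K) ≠ 0) (a b c d r s t : K) (ha : a ≠ 0)
    (hr : a*r^5 + b*r^3 + c*r^2 + d*r = 0) (hb : 10*a*r^2 + b = 0)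
    (hs : a*s^5 + b*s^3 + c*s^2 + d*s = 0) (hc : 10*a*s^3 + 3*b*s + c = 0)
    (ht : a*t^5 + b*t^3 + c*t^2 + d*t = 0)
    (ht' : 5*a*t^4 + 3*b*t^2 + 2*c*t + d = 0) : b = 0 ∧ c = 0 ∧ d = 0 := by
  obtain rfl : b = -10*a*r^2 := by linear_combination hb
  by_cases r0 : r = 0
  · subst r0
    obtain ⟨c, rfl⟩ : ∃ c', c = a * c' := ⟨c/a, by field_simp⟩
    obtain ⟨d, rfl⟩ : ∃ d', d = a * d' := ⟨d/a, by field_simp⟩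
    obtain ⟨h, h'⟩ := ca_core0 h2 h3 h193 c d s t
      (mul_left_cancel₀ ha (by linear_combination hs)) (mul_left_cancel₀ ha (by linear_combination hc))
      (mul_left_cancel₀ ha (by linear_combination ht)) (mul_left_cancel₀ ha (by linear_combination ht'))
    simp [h, h']
  exfalso
  obtain ⟨c, rfl⟩ : ∃ c', c = a * r^3 * c' := ⟨c/(a*r^3), by field_simp⟩
  obtain ⟨s, rfl⟩ : ∃ u, s = u * r := ⟨s/r, by field_simp⟩
  obtain ⟨t, rfl⟩ : ∃ u, t = u * r := ⟨t/r, by field_simp⟩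
  have hd : d = a*r^4*(9-c) := mul_left_cancel₀ r0 (by linear_combination hr)
  subst hd
  have n3 : a*r^3 ≠ 0 := by simp [ha, r0]
  have n4 : a*r^4 ≠ 0 := by simp [ha, r0]
  have n5 : a*r^5 ≠ 0 := by simp [ha, r0]
  exact ca_core1 h2 h3 h7 h11 h131 h599 h3541 h8009 c s t
    (mul_left_cancel₀ n5 (by linear_combination hs)) (mul_left_cancel₀ n3 (by linear_combination hc))
    (mul_left_cancel₀ n5 (by linear_combination ht)) (mul_left_cancel₀ n4 (by linear_combination ht'))

theorem casas_alvero_deg5_charp (p : ℕ) (hp : p.Prime)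
    (hp' : p ∉ ({2, 3, 5, 7, 11, 131, 193, 599, 3541, 8009} : Finset ℕ))
    (K : Type*) [Field K] [IsAlgClosed K] [CharP K p]
    (P : K[X]) (hdeg : P.degree = 5)
    (hcop : ∀ i : ℕ, 1 ≤ i → i ≤ 4 → ¬ IsCoprime P (hasseDeriv i P)) :
    ∃ c r : K, P = C c * (X - C r) ^ 5 := by
  have nz : ∀ q : ℕ, q.Prime → q ≠ p → (q : K) ≠ 0 := by
    intro q hq hne h
    rw [CharP.cast_eq_zero_iff K p] at h
    exact hne ((Nat.prime_dvd_prime_iff_eq hp hq).1 h).symm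
  simp only [Finset.mem_insert, Finset.mem_singleton, not_or] at hp'
  obtain ⟨p2, p3, p5, p7, p11, p131, p193, p599, p3541, p8009⟩ := hp'
  have h2 : (2:K) ≠ 0 := by exact_mod_cast nz 2 (by norm_num) (Ne.symm p2)
  have h3 : (3:K) ≠ 0 := by exact_mod_cast nz 3 (by norm_num) (Ne.symm p3)
  have h5 : (5:K) ≠ 0 := by exact_mod_cast nz 5 (by norm_num) (Ne.symm p5)
  have h7 : (7:K) ≠ 0 := by exact_mod_cast nz 7 (by norm_num) (Ne.symm p7)
  have h11 : (11:K) ≠ 0 := by exact_mod_cast nz 11 (by norm_num) (Ne.symm p11)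
  have h131 : (131:K) ≠ 0 := by exact_mod_cast nz 131 (by norm_num) (Ne.symm p131)
  have h193 : (193:K) ≠ 0 := by exact_mod_cast nz 193 (by norm_num) (Ne.symm p193)
  have h599 : (599:K) ≠ 0 := by exact_mod_cast nz 599 (by norm_num) (Ne.symm p599)
  have h3541 : (3541:K) ≠ 0 := by exact_mod_cast nz 3541 (by norm_num) (Ne.symm p3541)
  have h8009 : (8009:K) ≠ 0 := by exact_mod_cast nz 8009 (by norm_num) (Ne.symm p8009)
  have root : ∀ i : ℕ, 1 ≤ i → i ≤ 4 → ∃ x : K, P.eval x = 0 ∧ (hasseDeriv i P).eval x = 0 := by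
    intro i h1 h4
    by_contra hcon
    push Not at hcon
    apply hcop i h1 h4
    rw [Polynomial.isCoprime_iff_aeval_ne_zero_of_isAlgClosed K K]
    intro x
    by_cases hx : P.eval x = 0
    · right
      simpa using hcon x hx
    · left
      simpa using hx
  obtain ⟨w, hw, hw4⟩ := root 4 (by norm_num) (by norm_num)
  have hnat : P.natDegree = 5 := natDegree_eq_of_degree_eq_some hdeg
  obtain ⟨Q, hQ⟩ : ∃ Q, Q = taylor w P := ⟨_, rfl⟩
  have hQP : P = taylor (-w) Q := by
    rw [hQ, taylor_taylor]
    simp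
  have hQnat : Q.natDegree = 5 := by rw [hQ, natDegree_taylor, hnat]
  have hQ0 : Q.coeff 0 = 0 := by rw [hQ, taylor_coeff_zero, hw]
  have hQ4 : Q.coeff 4 = 0 := by rw [hQ, taylor_coeff, hw4]
  have ha : Q.coeff 5 ≠ 0 := by
    have : Q.leadingCoeff ≠ 0 := by
      rw [Ne, leadingCoeff_eq_zero]
      rintro h
      simp [h] at hQnat
    rwa [leadingCoeff, hQnat] at this
  have tr : ∀ i x, (hasseDeriv i P).eval x = (hasseDeriv i Q).eval (x - w) := by
    intro i x
    rw [← taylor_coeff, ← taylor_coeff, hQ, taylor_taylor]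
    simp
  have tr0 : ∀ x, P.eval x = Q.eval (x - w) := by
    intro x
    simpa using tr 0 x
  have hQe : Q = C (Q.coeff 5) * X^5 + C (Q.coeff 3) * X^3 + C (Q.coeff 2) * X^2
      + C (Q.coeff 1) * X := by
    conv_lhs => rw [Q.as_sum_range_C_mul_X_pow, hQnat]
    simp [Finset.sum_range_succ, hQ0, hQ4]
    ring
  have hm : Q = monomial 5 (Q.coeff 5) + monomial 3 (Q.coeff 3) + monomial 2 (Q.coeff 2)
      + monomial 1 (Q.coeff 1) := by
    simpa only [← C_mul_X_pow_eq_monomial, pow_one] using hQe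
  generalize Q.coeff 5 = a at *
  generalize Q.coeff 3 = b at *
  generalize Q.coeff 2 = c at *
  generalize Q.coeff 1 = d at *
  obtain ⟨r, hr, hr'⟩ := root 3 (by norm_num) (by norm_num)
  obtain ⟨s, hs, hs'⟩ := root 2 (by norm_num) (by norm_num)
  obtain ⟨t, ht, ht'⟩ := root 1 (by norm_num) (by norm_num)
  rw [tr0, hQe] at hr hs ht
  rw [tr, hm] at hr' hs' ht'
  have k1 : Nat.choose 5 2 = 10 := by decide
  have k2 : Nat.choose 5 3 = 10 := by decide
  have k3 : Nat.choose 1 3 = 0 := by decide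
  simp [hasseDeriv_monomial, k1, k2, k3] at hr hs ht hr' hs' ht'
  obtain ⟨rfl, rfl, rfl⟩ := ca_core h2 h3 h7 h11 h131 h193 h599 h3541 h8009 a b c d
    (r-w) (s-w) (t-w) ha (by linear_combination hr) (by linear_combination hr')
    (by linear_combination hs) (by linear_combination hs')
    (by linear_combination ht) (by linear_combination ht')
  refine ⟨a, w, ?_⟩
  rw [hQP, hQe]
  simp [taylor_apply, sub_eq_add_neg]
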